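/- Let s > 1 and let a ∈ C^∞(ℝ^d) satisfy uniform Gevrey-s bounds |∂^α a| ≤ A C^{|α|}(α!)^s. Then there exists C' > 0 such that for every N ∈ ℕ and 0 < h ≤ 1, the Gaussian average satisfies: (2πh)^{−d/2} ∫ e^{−|x|²/(2h)} a(x) dx = Σ_{j=0}^{N−1} (h^j/j!) (Δ/2)^j a(0) + R_N(h) with |R_N(h)| ≤ C'^{N+1} (N!)^{2s−1} h^N. Consequently, choosing N ≈ (1/(C'h))^{1/(2s−1)}, the remainder after optimal truncation is O(exp(−h^{−1/(2s−1)}/O(1))). -/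

import Mathlib

open MeasureTheory

/-- First-order partial derivative in the `i`-th coordinate direction. -/
noncomputable def pderiv1 {d : ℕ} (i : Fin d) (u : EuclideanSpace ℝ (Fin d) → ℂ) :
    EuclideanSpace ℝ (Fin d) → ℂ :=
  fun x => fderiv ℝ u x (EuclideanSpace.single i 1)

/-- Multi-index partial derivative `∂^α`. -/
noncomputable def mderiv {d : ℕ} (α : Fin d → ℕ) (u : EuclideanSpace ℝ (Fin d) → ℂ) :
    EuclideanSpace ℝ (Fin d) → ℂ :=
  List.foldr (fun i v => (pderiv1 i)^[α i] v) u (List.finRange d)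

/-- The Laplacian `Δu = ∑ ∂²u/∂x_i²` on `ℝ^d`. -/
noncomputable def lapE {d : ℕ} (u : EuclideanSpace ℝ (Fin d) → ℂ) :
    EuclideanSpace ℝ (Fin d) → ℂ :=
  fun x => ∑ i, fderiv ℝ (fun y => fderiv ℝ u y (EuclideanSpace.single i 1)) x
    (EuclideanSpace.single i 1)


/-- Iterated partial derivatives along a word of indices. -/
noncomputable def wderiv {d : ℕ} (L : List (Fin d)) (u : EuclideanSpace ℝ (Fin d) → ℂ) :
    EuclideanSpace ℝ (Fin d) → ℂ := L.foldr pderiv1 u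

lemma pderiv1_smooth {d : ℕ} (i : Fin d) {u : EuclideanSpace ℝ (Fin d) → ℂ}
    (hu : ContDiff ℝ (⊤ : ℕ∞) u) : ContDiff ℝ (⊤ : ℕ∞) (pderiv1 i u) := by
  unfold pderiv1
  exact (hu.fderiv_right (m := (⊤ : ℕ∞)) (by simp)).clm_apply contDiff_const

lemma wderiv_smooth {d : ℕ} (L : List (Fin d)) {u : EuclideanSpace ℝ (Fin d) → ℂ}
    (hu : ContDiff ℝ (⊤ : ℕ∞) u) : ContDiff ℝ (⊤ : ℕ∞) (wderiv L u) := by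
  induction L with
  | nil => exact hu
  | cons i L ih => exact pderiv1_smooth i ih

lemma smooth_diff {d : ℕ} {u : EuclideanSpace ℝ (Fin d) → ℂ}
    (hu : ContDiff ℝ (⊤ : ℕ∞) u) : Differentiable ℝ u := hu.differentiable (by simp)

lemma pderiv1_sum {d : ℕ} (i : Fin d) {f : Fin d → EuclideanSpace ℝ (Fin d) → ℂ}
    (hf : ∀ k, ContDiff ℝ (⊤ : ℕ∞) (f k)) :
    pderiv1 i (fun x => ∑ k, f k x) = fun x => ∑ k, pderiv1 i (f k) x := by
  funext x
  unfold pderiv1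
  rw [fderiv_fun_sum (fun k _ => (smooth_diff (hf k)).differentiableAt)]
  simp

lemma wderiv_sum {d : ℕ} (L : List (Fin d)) {f : Fin d → EuclideanSpace ℝ (Fin d) → ℂ}
    (hf : ∀ k, ContDiff ℝ (⊤ : ℕ∞) (f k)) :
    wderiv L (fun x => ∑ k, f k x) = fun x => ∑ k, wderiv L (f k) x := by
  induction L with
  | nil => rfl
  | cons i L ih =>
    change pderiv1 i (wderiv L _) = _
    rw [ih, pderiv1_sum i (fun k => wderiv_smooth L (hf k))]
    rfl

lemma pderiv1_comm {d : ℕ} (i j : Fin d) {u : EuclideanSpace ℝ (Fin d) → ℂ}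
    (hu : ContDiff ℝ (⊤ : ℕ∞) u) : pderiv1 i (pderiv1 j u) = pderiv1 j (pderiv1 i u) := by
  funext x
  have hs : IsSymmSndFDerivAt ℝ u x :=
    hu.contDiffAt.isSymmSndFDerivAt (by simpa using WithTop.coe_le_coe.2 (le_top : (2 : ℕ∞) ≤ ⊤))
  have hd : DifferentiableAt ℝ (fderiv ℝ u) x :=
    ((hu.fderiv_right (m := (⊤ : ℕ∞)) (by simp)).differentiable (by simp)).differentiableAt
  unfold pderiv1
  rw [fderiv_clm_apply hd (differentiableAt_const _), fderiv_clm_apply hd (differentiableAt_const _)]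
  simpa using hs.eq _ _

lemma lapE_eq {d : ℕ} (u : EuclideanSpace ℝ (Fin d) → ℂ) :
    lapE u = fun x => ∑ i, pderiv1 i (pderiv1 i u) x := rfl

lemma lapE_smooth {d : ℕ} {u : EuclideanSpace ℝ (Fin d) → ℂ}
    (hu : ContDiff ℝ (⊤ : ℕ∞) u) : ContDiff ℝ (⊤ : ℕ∞) (lapE u) := by
  rw [lapE_eq]
  exact ContDiff.sum fun i _ => pderiv1_smooth i (pderiv1_smooth i hu)

lemma wderiv_lapE {d : ℕ} (L : List (Fin d)) {u : EuclideanSpace ℝ (Fin d) → ℂ}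
    (hu : ContDiff ℝ (⊤ : ℕ∞) u) :
    wderiv L (lapE u) = fun x => ∑ i, wderiv (L ++ [i, i]) u x := by
  rw [lapE_eq, wderiv_sum L (fun i => pderiv1_smooth i (pderiv1_smooth i hu))]
  simp [wderiv]

lemma lapE_iter_bound {d : ℕ} (N : ℕ) : ∀ (u : EuclideanSpace ℝ (Fin d) → ℂ) (K : ℝ),
    ContDiff ℝ (⊤ : ℕ∞) u →
    (∀ L : List (Fin d), L.length = 2 * N → ∀ x, ‖wderiv L u x‖ ≤ K) →
    ∀ x, ‖(lapE^[N] u) x‖ ≤ (d : ℝ) ^ N * K := by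
  induction N with
  | zero => intro u K _ h x; simpa [wderiv] using h [] rfl x
  | succ N ih =>
    intro u K hu h x
    rw [Function.iterate_succ_apply]
    refine (ih (lapE u) (d * K) (lapE_smooth hu) ?_ x).trans (le_of_eq (by ring))
    intro L hL x
    rw [wderiv_lapE L hu]
    refine (norm_sum_le _ _).trans ?_
    refine (Finset.sum_le_sum (fun i _ => h (L ++ [i, i]) (by simp [hL]; ring) x)).trans ?_
    simp

/-- General version of `mderiv` along a list. -/
noncomputable def lderiv {d : ℕ} (l : List (Fin d)) (α : Fin d → ℕ)
    (u : EuclideanSpace ℝ (Fin d) → ℂ) : EuclideanSpace ℝ (Fin d) → ℂ :=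
  l.foldr (fun i v => (pderiv1 i)^[α i] v) u

lemma iter_smooth {d : ℕ} (i : Fin d) (n : ℕ) {u : EuclideanSpace ℝ (Fin d) → ℂ}
    (hu : ContDiff ℝ (⊤ : ℕ∞) u) : ContDiff ℝ (⊤ : ℕ∞) ((pderiv1 i)^[n] u) := by
  induction n with
  | zero => exact hu
  | succ n ih => rw [Function.iterate_succ_apply']; exact pderiv1_smooth i ih

lemma lderiv_smooth {d : ℕ} (l : List (Fin d)) (α : Fin d → ℕ)
    {u : EuclideanSpace ℝ (Fin d) → ℂ}
    (hu : ContDiff ℝ (⊤ : ℕ∞) u) : ContDiff ℝ (⊤ : ℕ∞) (lderiv l α u) := by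
  induction l with
  | nil => exact hu
  | cons i L ih => exact iter_smooth i _ ih

lemma pderiv1_iter_comm {d : ℕ} (i j : Fin d) (n : ℕ) {u : EuclideanSpace ℝ (Fin d) → ℂ}
    (hu : ContDiff ℝ (⊤ : ℕ∞) u) :
    pderiv1 i ((pderiv1 j)^[n] u) = (pderiv1 j)^[n] (pderiv1 i u) := by
  induction n with
  | zero => rfl
  | succ n ih =>
    rw [Function.iterate_succ_apply', Function.iterate_succ_apply',
      pderiv1_comm i j (iter_smooth j n hu), ih]

lemma lderiv_congr {d : ℕ} (l : List (Fin d)) (α β : Fin d → ℕ) (h : ∀ i ∈ l, α i = β i)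
    (u : EuclideanSpace ℝ (Fin d) → ℂ) : lderiv l α u = lderiv l β u := by
  induction l with
  | nil => rfl
  | cons i l ih =>
    change (pderiv1 i)^[α i] (lderiv l α u) = (pderiv1 i)^[β i] (lderiv l β u)
    rw [ih (fun k hk => h k (by simp [hk])), h i (by simp)]

lemma pderiv1_lderiv {d : ℕ} (i : Fin d) (l : List (Fin d)) (hl : l.Nodup) (hi : i ∈ l)
    (α : Fin d → ℕ) {u : EuclideanSpace ℝ (Fin d) → ℂ} (hu : ContDiff ℝ (⊤ : ℕ∞) u) :
    pderiv1 i (lderiv l α u) = lderiv l (α + Pi.single i 1) u := by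
  induction l with
  | nil => simp at hi
  | cons j l ih =>
    change pderiv1 i ((pderiv1 j)^[α j] (lderiv l α u)) =
      (pderiv1 j)^[(α + Pi.single i 1 : Fin d → ℕ) j] (lderiv l (α + Pi.single i 1) u)
    rw [List.nodup_cons] at hl
    by_cases hij : i = j
    · subst hij
      have h1 : lderiv l α u = lderiv l (α + Pi.single i 1) u := by
        apply lderiv_congr
        intro k hk
        have : k ≠ i := fun h => hl.1 (h ▸ hk)
        simp [this]
      rw [← h1]
      simp [Function.iterate_succ_apply']
    · have hi' : i ∈ l := by simpa [hij] using hi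
      rw [pderiv1_iter_comm _ _ _ (lderiv_smooth l α hu), ih hl.2 hi']
      simp [Ne.symm hij]

lemma wderiv_eq_mderiv {d : ℕ} (L : List (Fin d)) {u : EuclideanSpace ℝ (Fin d) → ℂ}
    (hu : ContDiff ℝ (⊤ : ℕ∞) u) :
    ∃ α : Fin d → ℕ, ∑ i, α i = L.length ∧ wderiv L u = mderiv α u := by
  induction L with
  | nil =>
    refine ⟨0, by simp, ?_⟩
    unfold mderiv wderiv
    induction (List.finRange d) with
    | nil => rfl
    | cons i l ih => simp [ih]
  | cons i L ih =>
    obtain ⟨α, h1, h2⟩ := ih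
    refine ⟨α + Pi.single i 1, by simp [Finset.sum_add_distrib, h1], ?_⟩
    change pderiv1 i (wderiv L u) = _
    rw [h2]
    exact pderiv1_lderiv i (List.finRange d) (List.nodup_finRange d) (List.mem_finRange i) α hu

lemma wderiv_gevrey {d : ℕ} {s A C : ℝ} (hs : 1 < s) (hA : 0 < A) (hC : 0 < C)
    {a : EuclideanSpace ℝ (Fin d) → ℂ} (ha : ContDiff ℝ (⊤ : ℕ∞) a)
    (hGev : ∀ (α : Fin d → ℕ) (x : EuclideanSpace ℝ (Fin d)),
      ‖mderiv α a x‖ ≤ A * C ^ (∑ i, α i) * (∏ i, ((α i).factorial : ℝ)) ^ s)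
    (L : List (Fin d)) (x : EuclideanSpace ℝ (Fin d)) :
    ‖wderiv L a x‖ ≤ A * C ^ L.length * (L.length.factorial : ℝ) ^ s := by
  obtain ⟨α, h1, h2⟩ := wderiv_eq_mderiv L ha
  rw [h2, ← h1]
  refine (hGev α x).trans ?_
  gcongr
  have := Nat.le_of_dvd (Nat.factorial_pos _) (Nat.prod_factorial_dvd_factorial_sum Finset.univ α)
  exact_mod_cast this

/-- The unnormalised standard Gaussian. -/
noncomputable def gam {d : ℕ} (y : EuclideanSpace ℝ (Fin d)) : ℝ := Real.exp (-(1 / 2) * ‖y‖ ^ 2)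

lemma gauss_int {d : ℕ} {b : ℝ} (hb : 0 < b) :
    Integrable (fun y : EuclideanSpace ℝ (Fin d) => Real.exp (-b * ‖y‖ ^ 2)) := by
  have h := GaussianFourier.integral_rexp_neg_mul_sq_norm (V := EuclideanSpace ℝ (Fin d)) hb
  by_contra hn
  rw [integral_undef hn] at h
  have : 0 < (Real.pi / b) ^ ((Module.finrank ℝ (EuclideanSpace ℝ (Fin d)) : ℝ) / 2) := by
    positivity
  linarith

lemma gam_pos {d : ℕ} (y : EuclideanSpace ℝ (Fin d)) : 0 < gam y := Real.exp_pos _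

lemma gam_int {d : ℕ} : Integrable (gam (d := d)) := gauss_int (by norm_num)

lemma gam_cont {d : ℕ} : Continuous (gam (d := d)) := by unfold gam; fun_prop

lemma gam_norm_int {d : ℕ} :
    Integrable (fun y : EuclideanSpace ℝ (Fin d) => gam y * ‖y‖) := by
  refine (gauss_int (d := d) (b := 1 / 4) (by norm_num)).mono'
    (gam_cont.mul continuous_norm).aestronglyMeasurable (Filter.Eventually.of_forall fun y => ?_)
  rw [Real.norm_of_nonneg (by have := gam_pos y; positivity)]
  have h1 : ‖y‖ ≤ Real.exp (1 / 4 * ‖y‖ ^ 2) := by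
    have := Real.add_one_le_exp (1 / 4 * ‖y‖ ^ 2)
    nlinarith [sq_nonneg (1 - ‖y‖ / 2)]
  calc gam y * ‖y‖ ≤ gam y * Real.exp (1 / 4 * ‖y‖ ^ 2) :=
        mul_le_mul_of_nonneg_left h1 (gam_pos y).le
    _ = _ := by unfold gam; rw [← Real.exp_add]; congr 1; ring

/-- Smooth functions all of whose derivatives are bounded. -/
def BddSm {d : ℕ} (b : EuclideanSpace ℝ (Fin d) → ℂ) : Prop :=
  ContDiff ℝ (⊤ : ℕ∞) b ∧ ∀ L : List (Fin d), ∃ K : ℝ, ∀ x, ‖wderiv L b x‖ ≤ K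

lemma BddSm.bdd {d : ℕ} {b : EuclideanSpace ℝ (Fin d) → ℂ} (hb : BddSm b) :
    ∃ K : ℝ, ∀ x, ‖b x‖ ≤ K := hb.2 []

lemma BddSm.pd {d : ℕ} {b : EuclideanSpace ℝ (Fin d) → ℂ} (hb : BddSm b) (i : Fin d) :
    BddSm (pderiv1 i b) := by
  refine ⟨pderiv1_smooth i hb.1, fun L => ?_⟩
  obtain ⟨K, hK⟩ := hb.2 (L ++ [i])
  exact ⟨K, by simpa [wderiv] using hK⟩

lemma BddSm.lap {d : ℕ} {b : EuclideanSpace ℝ (Fin d) → ℂ} (hb : BddSm b) :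
    BddSm (lapE b) := by
  refine ⟨lapE_smooth hb.1, fun L => ?_⟩
  choose K hK using fun i : Fin d => hb.2 (L ++ [i, i])
  refine ⟨∑ i, K i, fun x => ?_⟩
  rw [wderiv_lapE L hb.1]
  exact (norm_sum_le _ _).trans (Finset.sum_le_sum fun i _ => hK i x)

lemma BddSm.cont {d : ℕ} {b : EuclideanSpace ℝ (Fin d) → ℂ} (hb : BddSm b) (t : ℝ) :
    Continuous (fun y => b (t • y)) := hb.1.continuous.comp (continuous_const_smul t)

lemma BddSm.int {d : ℕ} {b : EuclideanSpace ℝ (Fin d) → ℂ} (hb : BddSm b) (t : ℝ) :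
    Integrable (fun y => gam y • b (t • y)) := by
  obtain ⟨K, hK⟩ := hb.bdd
  refine (gam_int.mul_const K).mono'
    (gam_cont.smul (hb.cont t)).aestronglyMeasurable (Filter.Eventually.of_forall fun y => ?_)
  rw [norm_smul, Real.norm_of_nonneg (gam_pos y).le]
  exact mul_le_mul_of_nonneg_left (hK _) (gam_pos y).le

lemma BddSm.int' {d : ℕ} {b : EuclideanSpace ℝ (Fin d) → ℂ} (hb : BddSm b) (t : ℝ) (i : Fin d) :
    Integrable (fun y => (gam y * y i) • b (t • y)) := by
  obtain ⟨K, hK⟩ := hb.bdd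
  refine (gam_norm_int.mul_const K).mono'
    ((gam_cont.mul (by fun_prop)).smul (hb.cont t)).aestronglyMeasurable
    (Filter.Eventually.of_forall fun y => ?_)
  rw [norm_smul, norm_mul, Real.norm_of_nonneg (gam_pos y).le]
  have := (gam_pos y).le
  gcongr
  · exact PiLp.norm_apply_le y i
  · exact hK _

lemma gam_fderiv {d : ℕ} (y : EuclideanSpace ℝ (Fin d)) (i : Fin d) :
    DifferentiableAt ℝ gam y ∧
    fderiv ℝ gam y (EuclideanSpace.single i 1) = -(gam y * y i) := by
  have h := (((hasStrictFDerivAt_norm_sq y).hasFDerivAt).const_mul (-(1 / 2) : ℝ)).exp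
  refine ⟨h.differentiableAt, ?_⟩
  change fderiv ℝ (fun y => Real.exp (-(1 / 2) * ‖y‖ ^ 2)) y _ = _
  rw [h.fderiv]
  simp [gam, EuclideanSpace.inner_single_right]

lemma fderiv_scale {d : ℕ} {b : EuclideanSpace ℝ (Fin d) → ℂ} (hb : BddSm b) (t : ℝ)
    (y : EuclideanSpace ℝ (Fin d)) :
    HasFDerivAt (fun y => b (t • y)) (t • fderiv ℝ b (t • y)) y := by
  have h1 := (smooth_diff hb.1 (t • y)).hasFDerivAt
  have h2 : HasFDerivAt (fun y : EuclideanSpace ℝ (Fin d) => t • y)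
    (t • ContinuousLinearMap.id ℝ _) y := (hasFDerivAt_id y).const_smul t
  have := h1.comp y h2
  have e : (fderiv ℝ b (t • y)).comp (t • ContinuousLinearMap.id ℝ (EuclideanSpace ℝ (Fin d)))
      = t • fderiv ℝ b (t • y) := by
    ext v
    simp
  rw [e] at this
  exact this

lemma ibp {d : ℕ} {b : EuclideanSpace ℝ (Fin d) → ℂ} (hb : BddSm b) (t : ℝ) (i : Fin d) :
    ∫ y, (gam y * y i) • b (t • y) = t • ∫ y, gam y • pderiv1 i b (t • y) := by
  have hg : ∀ y, fderiv ℝ (fun y => b (t • y)) y (EuclideanSpace.single i 1)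
      = t • pderiv1 i b (t • y) := fun y => by
    rw [(fderiv_scale hb t y).fderiv]; rfl
  have h := integral_smul_fderiv_eq_neg_fderiv_smul_of_integrable
    (μ := (volume : Measure (EuclideanSpace ℝ (Fin d))))
    (f := gam) (g := fun y => b (t • y)) (v := EuclideanSpace.single i 1)
    (by
      simp only [(gam_fderiv _ i).2, neg_smul]
      exact (hb.int' t i).neg)
    (by
      simp only [hg]
      have := ((hb.pd i).int t).smul t
      refine this.congr (Filter.Eventually.of_forall fun y => ?_)
      exact smul_comm t (gam y) (pderiv1 i b (t • y)))
    (hb.int t) (fun y _ => (gam_fderiv y i).1)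
    (fun y _ => (fderiv_scale hb t y).differentiableAt)
  simp only [hg, (gam_fderiv _ i).2, neg_smul, integral_neg, neg_neg] at h
  rw [← h, ← integral_smul]
  congr 1; funext y; exact smul_comm (gam y) t (pderiv1 i b (t • y))

lemma fderiv_expand {d : ℕ} (b : EuclideanSpace ℝ (Fin d) → ℂ) (x y : EuclideanSpace ℝ (Fin d)) :
    fderiv ℝ b x y = ∑ i, y i • pderiv1 i b x := by
  have hy : y = ∑ i, y i • EuclideanSpace.single i (1 : ℝ) := by
    ext k
    simp [Finset.sum_apply, Pi.single_apply]
  conv_lhs => rw [hy]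
  simp only [map_sum, map_smul]
  rfl

lemma key_deriv {d : ℕ} {b : EuclideanSpace ℝ (Fin d) → ℂ} (hb : BddSm b) (t : ℝ) :
    HasDerivAt (fun t : ℝ => ∫ y, gam y • b (t • y)) (t • ∫ y, gam y • lapE b (t • y)) t := by
  choose K hK using fun i : Fin d => (hb.pd i).bdd
  have hd : ∀ (y : EuclideanSpace ℝ (Fin d)) (τ : ℝ),
      HasDerivAt (fun τ : ℝ => gam y • b (τ • y))
        (∑ i, (gam y * y i) • pderiv1 i b (τ • y)) τ := by
    intro y τ
    have h1 := (smooth_diff hb.1 (τ • y)).hasFDerivAt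
    have h2 : HasDerivAt (fun τ : ℝ => τ • y) y τ := by
      simpa using (hasDerivAt_id τ).smul_const y
    have h3 := (h1.comp_hasDerivAt τ h2).const_smul (gam y)
    rw [fderiv_expand, Finset.smul_sum] at h3
    simp only [smul_smul] at h3
    exact h3
  have h := (hasDerivAt_integral_of_dominated_loc_of_deriv_le
    (μ := (volume : Measure (EuclideanSpace ℝ (Fin d))))
    (F := fun τ y => gam y • b (τ • y))
    (F' := fun τ y => ∑ i, (gam y * y i) • pderiv1 i b (τ • y)) (x₀ := t) (s := Set.univ)
    (bound := fun y => ∑ i, gam y * ‖y‖ * K i) Filter.univ_mem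
    (Filter.Eventually.of_forall fun τ => (hb.int τ).aestronglyMeasurable) (hb.int t)
    (integrable_finsetSum _ fun i _ => (hb.pd i).int' t i).aestronglyMeasurable
    (Filter.Eventually.of_forall fun y τ _ => by
      refine (norm_sum_le _ _).trans (Finset.sum_le_sum fun i _ => ?_)
      rw [norm_smul, norm_mul, Real.norm_of_nonneg (gam_pos y).le]
      have := (gam_pos y).le
      gcongr
      · exact PiLp.norm_apply_le y i
      · exact hK i _)
    (integrable_finsetSum _ fun i _ => gam_norm_int.mul_const (K i))
    (Filter.Eventually.of_forall fun y τ _ => hd y τ)).2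
  refine h.congr_deriv ?_
  rw [integral_finsetSum _ fun i _ => (hb.pd i).int' t i]
  simp only [ibp (hb.pd _)]
  rw [← Finset.smul_sum, ← integral_finsetSum _ fun i _ => ((hb.pd i).pd i).int t]
  simp only [lapE_eq, Finset.smul_sum]

lemma gauss_taylor {d : ℕ} (N : ℕ) : ∀ (b : EuclideanSpace ℝ (Fin d) → ℂ) (M : ℝ), BddSm b →
    (∀ x, ‖(lapE^[N] b) x‖ ≤ M) → ∀ t : ℝ, 0 ≤ t →
    ‖(∫ y, gam y • b (t • y)) - (∫ y : EuclideanSpace ℝ (Fin d), gam y) •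
        ∑ j ∈ Finset.range N, (t ^ (2 * j) / (2 ^ j * (j.factorial : ℝ))) • (lapE^[j] b) 0‖ ≤
      (∫ y : EuclideanSpace ℝ (Fin d), gam y) * M * (t ^ (2 * N) / (2 ^ N * (N.factorial : ℝ))) := by
  induction N with
  | zero =>
    intro b M hb hM t ht
    simp only [Finset.range_zero, Finset.sum_empty, smul_zero, sub_zero]
    refine (norm_integral_le_of_norm_le (gam_int.mul_const M)
      (Filter.Eventually.of_forall fun y => ?_)).trans (le_of_eq ?_)
    · rw [norm_smul, Real.norm_of_nonneg (gam_pos y).le]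
      exact mul_le_mul_of_nonneg_left (hM _) (gam_pos y).le
    · rw [integral_mul_const]; simp
  | succ N ih =>
    intro b M hb hM t ht
    set Z := ∫ y : EuclideanSpace ℝ (Fin d), gam y with hZ
    have IH := ih (lapE b) M hb.lap hM
    have hpd : ∀ (j : ℕ) (τ : ℝ), HasDerivAt (fun τ : ℝ => τ ^ (2 * (j + 1)) / (2 ^ (j + 1) * ((j + 1).factorial : ℝ)))
        (τ * (τ ^ (2 * j) / (2 ^ j * (j.factorial : ℝ)))) τ := by
      intro j τ
      have := (hasDerivAt_pow (2 * (j + 1)) τ).div_const (2 ^ (j + 1) * ((j + 1).factorial : ℝ))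
      refine this.congr_deriv ?_
      have : (j.factorial : ℝ) ≠ 0 := by exact_mod_cast j.factorial_ne_zero
      rw [Nat.factorial_succ, show 2 * (j + 1) - 1 = 2 * j + 1 by omega]
      push_cast
      field_simp
      ring
    have hder : ∀ τ : ℝ, HasDerivAt (fun τ : ℝ => (∫ y, gam y • b (τ • y)) - Z •
        ∑ j ∈ Finset.range (N + 1), (τ ^ (2 * j) / (2 ^ j * (j.factorial : ℝ))) • (lapE^[j] b) 0)
        (τ • ((∫ y, gam y • lapE b (τ • y)) - Z •
        ∑ j ∈ Finset.range N, (τ ^ (2 * j) / (2 ^ j * (j.factorial : ℝ))) • (lapE^[j] (lapE b)) 0)) τ := by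
      intro τ
      have h1 : HasDerivAt (fun τ : ℝ => ∑ j ∈ Finset.range N,
          (τ ^ (2 * (j + 1)) / (2 ^ (j + 1) * ((j + 1).factorial : ℝ))) • (lapE^[j + 1] b) 0)
          (∑ j ∈ Finset.range N, (τ * (τ ^ (2 * j) / (2 ^ j * (j.factorial : ℝ)))) • (lapE^[j + 1] b) 0) τ :=
        HasDerivAt.fun_sum fun j _ => (hpd j τ).smul_const _
      have h2 := (key_deriv hb τ).sub ((h1.add_const
        (((1 : ℝ)) • (lapE^[0] b) 0)).const_smul Z)
      have e : (fun τ : ℝ => (∫ y, gam y • b (τ • y)) - Z •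
          ∑ j ∈ Finset.range (N + 1), (τ ^ (2 * j) / (2 ^ j * (j.factorial : ℝ))) • (lapE^[j] b) 0)
          = ((fun t => ∫ y, gam y • b (t • y)) - Z • fun x : ℝ => ∑ j ∈ Finset.range N,
          (x ^ (2 * (j + 1)) / (2 ^ (j + 1) * ((j + 1).factorial : ℝ))) • (lapE^[j + 1] b) 0 +
          (1 : ℝ) • (lapE^[0] b) 0) := by
        funext τ
        simp [Finset.sum_range_succ']
      rw [e]
      refine h2.congr_deriv ?_
      · rw [smul_sub, smul_comm τ Z]
        simp only [Finset.smul_sum, smul_smul, Function.iterate_succ_apply, mul_assoc]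
    have := image_norm_le_of_norm_deriv_right_le_deriv_boundary' (a := 0) (b := t)
      (fun τ _ => (hder τ).continuousAt.continuousWithinAt)
      (fun τ _ => (hder τ).hasDerivWithinAt)
      (B := fun τ => Z * M * (τ ^ (2 * (N + 1)) / (2 ^ (N + 1) * ((N + 1).factorial : ℝ))))
      (B' := fun τ => Z * M * (τ * (τ ^ (2 * N) / (2 ^ N * (N.factorial : ℝ)))))
      (by
        have e : ∫ y : EuclideanSpace ℝ (Fin d), gam y • b 0 = Z • b 0 := integral_smul_const _ _
        simp [Finset.sum_range_succ', e, -Complex.real_smul])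
      (fun τ _ => ((hpd N τ).const_mul (Z * M)).continuousAt.continuousWithinAt)
      (fun τ _ => ((hpd N τ).const_mul (Z * M)).hasDerivWithinAt)
      (fun τ hτ => by
        rw [norm_smul, Real.norm_of_nonneg hτ.1]
        refine (mul_le_mul_of_nonneg_left (IH τ hτ.1) hτ.1).trans (le_of_eq (by ring)))
      (Set.right_mem_Icc.2 ht)
    exact this

lemma gauss_scale {d : ℕ} (a : EuclideanSpace ℝ (Fin d) → ℂ) {h : ℝ} (hh : 0 < h) :
    (((2 * Real.pi * h) ^ (-(d : ℝ) / 2) : ℝ) : ℂ) *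
      (∫ x : EuclideanSpace ℝ (Fin d), Complex.exp (((-‖x‖ ^ 2 / (2 * h) : ℝ)) : ℂ) * a x) =
    (∫ y : EuclideanSpace ℝ (Fin d), gam y)⁻¹ • ∫ y, gam y • a (Real.sqrt h • y) := by
  have hZ : ∫ y : EuclideanSpace ℝ (Fin d), gam y = (2 * Real.pi) ^ ((d : ℝ) / 2) := by
    unfold gam
    rw [GaussianFourier.integral_rexp_neg_mul_sq_norm (by norm_num)]
    simp [div_eq_mul_inv, mul_comm]
  have h1 := Measure.integral_comp_smul_of_nonneg
    (volume : Measure (EuclideanSpace ℝ (Fin d)))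
    (fun x => Complex.exp (((-‖x‖ ^ 2 / (2 * h) : ℝ)) : ℂ) * a x) (Real.sqrt h)
    (hR := Real.sqrt_nonneg h)
  have h2 : ∀ y : EuclideanSpace ℝ (Fin d),
      Complex.exp (((-‖Real.sqrt h • y‖ ^ 2 / (2 * h) : ℝ)) : ℂ) * a (Real.sqrt h • y) =
      gam y • a (Real.sqrt h • y) := by
    intro y
    rw [norm_smul, Real.norm_of_nonneg (Real.sqrt_nonneg h), mul_pow, Real.sq_sqrt hh.le,
      Complex.real_smul, gam, Complex.ofReal_exp]
    congr 3
    field_simp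
  simp only [h2] at h1
  rw [h1, smul_smul, hZ, ← Complex.real_smul]
  congr 1
  rw [finrank_euclideanSpace_fin, Real.mul_rpow (by positivity) hh.le, neg_div,
    Real.rpow_neg (by positivity), Real.rpow_neg hh.le, Real.sqrt_eq_rpow,
    ← Real.rpow_natCast, ← Real.rpow_mul hh.le]
  congr 3
  ring

lemma gevrey_arith (d : ℕ) {s A C : ℝ} (hs : 1 < s) (hA : 0 < A) (hC : 0 < C) (N : ℕ) {h : ℝ}
    (hh : 0 < h) :
    ((d : ℝ) ^ N * (A * C ^ (2 * N) * ((2 * N).factorial : ℝ) ^ s)) * h ^ N /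
      (2 ^ N * (N.factorial : ℝ)) ≤
    (A + d * C ^ 2 * 4 ^ s + 1) ^ (N + 1) * (N.factorial : ℝ) ^ (2 * s - 1) * h ^ N := by
  have hN : (0 : ℝ) < N.factorial := by exact_mod_cast N.factorial_pos
  have h1 : ((2 * N).factorial : ℝ) ≤ 4 ^ N * (N.factorial : ℝ) ^ 2 := by
    have e := Nat.centralBinom_le_four_pow N
    have e2 := Nat.choose_mul_factorial_mul_factorial (n := 2 * N) (k := N) (by omega)
    rw [← Nat.centralBinom_eq_two_mul_choose, show 2 * N - N = N by omega] at e2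
    have : (2 * N).factorial ≤ 4 ^ N * N.factorial ^ 2 := by
      rw [← e2, mul_assoc, ← pow_two]; gcongr
    exact_mod_cast this
  have h2 : ((2 * N).factorial : ℝ) ^ s ≤ (4 ^ s) ^ N * ((N.factorial : ℝ) ^ (2 * s - 1) * N.factorial) := by
    refine (Real.rpow_le_rpow (by positivity) h1 (by linarith)).trans (le_of_eq ?_)
    rw [Real.mul_rpow (by positivity) (by positivity), ← Real.rpow_natCast (4 : ℝ) N,
      ← Real.rpow_natCast ((4 : ℝ) ^ s) N, ← Real.rpow_mul (by norm_num),
      ← Real.rpow_mul (by norm_num), mul_comm s, ← Real.rpow_natCast _ 2,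
      ← Real.rpow_mul hN.le, Real.rpow_sub_one hN.ne']
    field_simp
    push_cast
    ring_nf
  have h4 : (0 : ℝ) < 4 ^ s := by positivity
  rw [div_le_iff₀ (by positivity)]
  have h3 : A * (d * C ^ 2 * 4 ^ s) ^ N ≤ (A + d * C ^ 2 * 4 ^ s + 1) ^ (N + 1) := by
    rw [pow_succ' _ N]
    have : 0 ≤ d * C ^ 2 * 4 ^ s := by positivity
    gcongr <;> linarith
  have h5 : (1 : ℝ) ≤ 2 ^ N := one_le_pow₀ (by norm_num)
  calc _ ≤ ((d : ℝ) ^ N * (A * C ^ (2 * N) * ((4 ^ s) ^ N * ((N.factorial : ℝ) ^ (2 * s - 1) * N.factorial)))) * h ^ N := by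
        gcongr
    _ = (A * (d * C ^ 2 * 4 ^ s) ^ N) * (N.factorial : ℝ) ^ (2 * s - 1) * h ^ N * (1 * N.factorial) := by
        rw [mul_pow, mul_pow, ← pow_mul]; ring
    _ ≤ _ := by gcongr

lemma optimal_trunc {s C₁ : ℝ} (hs : 1 < s) (hC : 1 ≤ C₁) {h : ℝ} (hh : 0 < h) :
    ∃ N : ℕ, C₁ ^ (N + 1) * (N.factorial : ℝ) ^ (2 * s - 1) * h ^ N ≤
      (Real.exp 1 * C₁) * Real.exp (-(h ^ (-(1 / (2 * s - 1)))) / (Real.exp 1 * C₁)) := by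
  set σ := 2 * s - 1 with hσ
  have hσ1 : 1 < σ := by rw [hσ]; linarith
  have hσ0 : 0 < σ := by linarith
  set E := Real.exp 1 * C₁ with hE
  have he : 1 ≤ Real.exp 1 := Real.one_le_exp (by norm_num)
  have hE1 : 1 ≤ E := one_le_mul_of_one_le_of_one_le he hC
  have hE0 : 0 < E := by linarith
  set X := (E * h) ^ (-(1 / σ)) with hX
  have hX0 : 0 < X := by positivity
  have hXσ : X ^ σ = (E * h)⁻¹ := by
    rw [hX, ← Real.rpow_mul (by positivity)]
    rw [show -(1 / σ) * σ = -1 by field_simp, Real.rpow_neg_one]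
  refine ⟨⌊X⌋₊, ?_⟩
  set N := ⌊X⌋₊ with hN
  have hNX : (N : ℝ) ≤ X := Nat.floor_le hX0.le
  have hXN : X < N + 1 := Nat.lt_floor_add_one X
  have h1 : (N.factorial : ℝ) ^ σ ≤ ((E * h)⁻¹) ^ N := by
    have : (N.factorial : ℝ) ≤ (N : ℝ) ^ N := by exact_mod_cast Nat.factorial_le_pow N
    calc (N.factorial : ℝ) ^ σ ≤ (X ^ N) ^ σ := by
          apply Real.rpow_le_rpow (by positivity) _ hσ0.le
          exact this.trans (by gcongr)
      _ = _ := by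
          rw [← hXσ, ← Real.rpow_natCast, ← Real.rpow_mul hX0.le, mul_comm, Real.rpow_mul hX0.le,
            Real.rpow_natCast]
  have h2 : C₁ ^ (N + 1) * (N.factorial : ℝ) ^ σ * h ^ N ≤ C₁ * Real.exp (-N) := by
    calc _ ≤ C₁ ^ (N + 1) * ((E * h)⁻¹) ^ N * h ^ N := by gcongr
      _ = C₁ * (Real.exp (-1)) ^ N := by
        rw [hE, pow_succ', Real.exp_neg, mul_assoc, mul_assoc, ← mul_pow, ← mul_pow]
        congr 2
        field_simp
      _ = _ := by rw [← Real.exp_nat_mul]; simp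
  have h3 : h ^ (-(1 / σ)) / E ≤ X := by
    rw [hX, Real.mul_rpow hE0.le hh.le, div_eq_inv_mul]
    gcongr
    rw [← Real.rpow_neg_one]
    apply Real.rpow_le_rpow_of_exponent_le hE1
    rw [neg_le_neg_iff, div_le_one hσ0]; exact hσ1.le
  refine h2.trans ?_
  have h6 : E * Real.exp (-(h ^ (-(1 / σ))) / E) = C₁ * Real.exp (1 + -(h ^ (-(1 / σ))) / E) := by
    rw [Real.exp_add, hE]; ring
  rw [h6]
  gcongr
  rw [neg_div]; linarith

/-- Gaussian averages of uniformly Gevrey-s functions admit heat expansions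
with remainders `C'^{N+1}(N!)^{2s-1} h^N`; optimal truncation yields a remainder
`O(exp(-h^{-1/(2s-1)}/O(1)))`. -/
theorem gaussian_average_gevrey (d : ℕ) (s A C : ℝ) (hs : 1 < s) (hA : 0 < A) (hC : 0 < C)
    (a : EuclideanSpace ℝ (Fin d) → ℂ) (ha : ContDiff ℝ (⊤ : ℕ∞) a)
    (hGev : ∀ (α : Fin d → ℕ) (x : EuclideanSpace ℝ (Fin d)),
      ‖mderiv α a x‖ ≤ A * C ^ (∑ i, α i) * (∏ i, ((α i).factorial : ℝ)) ^ s) :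
    ∃ C' : ℝ, 0 < C' ∧
      (∀ (N : ℕ) (h : ℝ), 0 < h → h ≤ 1 →
        ‖(((2 * Real.pi * h) ^ (-(d : ℝ) / 2) : ℝ) : ℂ) *
              (∫ x : EuclideanSpace ℝ (Fin d),
                Complex.exp (((-‖x‖ ^ 2 / (2 * h) : ℝ)) : ℂ) * a x) -
            ∑ j ∈ Finset.range N,
              ((h ^ j / (j.factorial : ℝ) : ℝ) : ℂ) * (1 / 2 : ℂ) ^ j * (lapE^[j] a) 0‖ ≤
          C' ^ (N + 1) * ((N.factorial : ℝ)) ^ (2 * s - 1) * h ^ N) ∧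
      (∀ h : ℝ, 0 < h → h ≤ 1 → ∃ N : ℕ,
        ‖(((2 * Real.pi * h) ^ (-(d : ℝ) / 2) : ℝ) : ℂ) *
              (∫ x : EuclideanSpace ℝ (Fin d),
                Complex.exp (((-‖x‖ ^ 2 / (2 * h) : ℝ)) : ℂ) * a x) -
            ∑ j ∈ Finset.range N,
              ((h ^ j / (j.factorial : ℝ) : ℝ) : ℂ) * (1 / 2 : ℂ) ^ j * (lapE^[j] a) 0‖ ≤
          C' * Real.exp (-(h ^ (-(1 / (2 * s - 1)))) / C')) := by
  set C₁ : ℝ := A + d * C ^ 2 * 4 ^ s + 1 with hC₁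
  have hC₁1 : 1 ≤ C₁ := by
    have : (0 : ℝ) ≤ d * C ^ 2 * 4 ^ s := by positivity
    rw [hC₁]; linarith
  have hw := wderiv_gevrey hs hA hC ha hGev
  have hb : BddSm a := ⟨ha, fun L => ⟨_, hw L⟩⟩
  have main : ∀ (N : ℕ) (h : ℝ), 0 < h → h ≤ 1 →
        ‖(((2 * Real.pi * h) ^ (-(d : ℝ) / 2) : ℝ) : ℂ) *
              (∫ x : EuclideanSpace ℝ (Fin d),
                Complex.exp (((-‖x‖ ^ 2 / (2 * h) : ℝ)) : ℂ) * a x) -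
            ∑ j ∈ Finset.range N,
              ((h ^ j / (j.factorial : ℝ) : ℝ) : ℂ) * (1 / 2 : ℂ) ^ j * (lapE^[j] a) 0‖ ≤
          C₁ ^ (N + 1) * ((N.factorial : ℝ)) ^ (2 * s - 1) * h ^ N := by
    intro N h hh _
    have hlap := lapE_iter_bound N a (A * C ^ (2 * N) * ((2 * N).factorial : ℝ) ^ s) ha
      (fun L hL x => by have := hw L x; rwa [hL] at this)
    have hT := gauss_taylor N a _ hb hlap (Real.sqrt h) (Real.sqrt_nonneg h)
    have hZ : 0 < ∫ y : EuclideanSpace ℝ (Fin d), gam y := by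
      unfold gam
      rw [GaussianFourier.integral_rexp_neg_mul_sq_norm (by norm_num)]
      positivity
    set Z := ∫ y : EuclideanSpace ℝ (Fin d), gam y with hZdef
    refine le_trans (le_of_eq ?_) (le_trans
      (mul_le_mul_of_nonneg_left hT (inv_nonneg.2 hZ.le)) ?_)
    · rw [gauss_scale a hh, ← hZdef]
      conv_rhs => rw [← Real.norm_of_nonneg (inv_nonneg.2 hZ.le), ← norm_smul, smul_sub, smul_smul,
        inv_mul_cancel₀ hZ.ne', one_smul]
      congr 2
      refine Finset.sum_congr rfl fun j _ => ?_
      rw [pow_mul, Real.sq_sqrt hh.le, Complex.real_smul]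
      congr 1
      push_cast
      rw [div_pow, one_pow]
      field_simp
    · refine le_trans (le_of_eq ?_) (gevrey_arith d hs hA hC N hh)
      rw [pow_mul (Real.sqrt h), Real.sq_sqrt hh.le]
      field_simp
  have hE : C₁ ≤ Real.exp 1 * C₁ :=
    le_mul_of_one_le_left (by linarith) (Real.one_le_exp (by norm_num))
  refine ⟨Real.exp 1 * C₁, by positivity, fun N h hh hh1 => ?_, fun h hh hh1 => ?_⟩
  · refine (main N h hh hh1).trans ?_
    gcongr
  · obtain ⟨N, hN⟩ := optimal_trunc hs hC₁1 hh
    exact ⟨N, (main N h hh hh1).trans hN⟩
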